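/- arXiv:1411.3995 — 2 statements merged into one kernel-verified Lean document; each statement's English description precedes it below -/
import Mathlib

section
/- A real X is Martin-Löf BP random if and only if there is no primitive recursive sequence (G_n)_{n∈ℕ} of finite sets of binary strings such that μ([G_n]) = 2^{−n} for every n and X ∈ ⋂_n [G_n]. -/
namespace BP



/-- The finite binary string `(X 0, …, X (n−1))`. -/
def take (X : ℕ → Bool) (n : ℕ) : List Bool := (List.range n).map X

/-- `X ∈ [G]`: the real `X` extends some string of the finite set (list) `G`. -/
def Mem (X : ℕ → Bool) (G : List (List Bool)) : Prop :=
  ∃ τ ∈ G, take X τ.length = τ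

/-- The maximum length of a string in `G`. -/
def maxLen (G : List (List Bool)) : ℕ := (G.map List.length).foldr max 0

/-- The list of all binary strings of length `L`. -/
def allStrings (L : ℕ) : List (List Bool) :=
  (List.range (2 ^ L)).map fun k => (List.range L).map fun i => k.testBit i

/-- The uniform (fair-coin) measure of the clopen set `[G]`, computed by counting
which strings of length `maxLen G` extend a member of `G`. -/
def mu (G : List (List Bool)) : ℚ :=
  (((allStrings (maxLen G)).filter fun σ => G.any fun τ => decide (τ <+: σ)).length : ℚ)
    / 2 ^ maxLen G

/-- The uniform measure of `[G] ∩ [τ]`. -/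
def muCap (G : List (List Bool)) (τ : List Bool) : ℚ :=
  (((allStrings (max (maxLen G) τ.length)).filter fun σ =>
      decide (τ <+: σ) && (G.any fun ρ => decide (ρ <+: σ))).length : ℚ)
    / 2 ^ max (maxLen G) τ.length

/-- A primitive recursive test: a primitive recursive sequence of finite sets of
binary strings with `μ([Gₙ]) ≤ 2⁻ⁿ`. -/
def IsTest (G : ℕ → List (List Bool)) : Prop :=
  Primrec G ∧ ∀ n, mu (G n) ≤ ((2 : ℚ) ^ n)⁻¹

/-- `X` is Martin-Löf BP random. -/
def MLBPRandom (X : ℕ → Bool) : Prop :=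
  ∀ G : ℕ → List (List Bool), IsTest G → ∃ n, ¬ Mem X (G n)

/-- A weak primitive recursive test. -/
def IsWeakTest (G : ℕ → List (List Bool)) : Prop :=
  IsTest G ∧ ∃ ℓ : ℕ → ℕ, Primrec ℓ ∧ (∀ n, ∀ τ ∈ G n, τ.length = ℓ n) ∧
    ∀ n, ∀ τ ∈ G n, muCap (G (n + 1)) τ ≤ (1 / 2) * ((2 : ℚ) ^ τ.length)⁻¹

/-- A martingale with values in the nonnegative rationals. -/
def IsMartingale (d : List Bool → ℚ) : Prop :=
  d [] = 1 ∧ (∀ σ, 0 ≤ d σ) ∧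
    ∀ σ, d σ = (d (σ ++ [false]) + d (σ ++ [true])) / 2

/-- The martingale `d` succeeds primitive recursively on `X`. -/
def SucceedsPR (d : List Bool → ℚ) (X : ℕ → Bool) : Prop :=
  ∃ f : ℕ → ℕ, Primrec f ∧ ∀ n, (2 : ℚ) ^ n ≤ d (take X (f n))

/-- `X` is martingale BP random. -/
def MartingaleBPRandom (X : ℕ → Bool) : Prop :=
  ¬ ∃ d : List Bool → ℚ, Primrec d ∧ IsMartingale d ∧ SucceedsPR d X

/-- `X` is primitive recursively compressed by the machine `M`. -/
def CompressedBy (M : List Bool → List Bool) (X : ℕ → Bool) : Prop :=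
  ∃ f : ℕ → ℕ, Primrec f ∧
    ∀ c, ∃ σ : List Bool, σ.length ≤ f c - c ∧ M σ = take X (f c)

/-- `X` is Kolmogorov BP random. -/
def KolmogorovBPRandom (X : ℕ → Bool) : Prop :=
  ¬ ∃ M : List Bool → List Bool, Primrec M ∧ CompressedBy M X

/-- `M` is a (total) process machine: it is extension preserving. -/
def IsProcessMachine (M : List Bool → List Bool) : Prop :=
  ∀ σ τ : List Bool, σ <+: τ → M σ <+: M τ

/-- `M` is a quick process BP machine. -/
def IsQuickProcessBP (M : List Bool → List Bool) : Prop :=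
  Primrec M ∧ IsProcessMachine M ∧
    ∃ h : ℕ → ℕ, Primrec h ∧ Monotone h ∧ (∀ k, ∃ n, k ≤ h n) ∧
      ∀ τ : List Bool, h τ.length ≤ (M τ).length

/-- `X` is quick process BP random. -/
def QuickProcessBPRandom (X : ℕ → Bool) : Prop :=
  ¬ ∃ M : List Bool → List Bool, IsQuickProcessBP M ∧ CompressedBy M X

/-- The number of `i < n` with `X i = true`. -/
def cardBelow (X : ℕ → Bool) (n : ℕ) : ℕ := (List.range n).countP X

theorem mem_allStrings {L : ℕ} {σ : List Bool} : σ ∈ allStrings L ↔ σ.length = L := by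
  simp only [allStrings, List.mem_map, List.mem_range]
  constructor
  · rintro ⟨k, -, rfl⟩
    simp
  · rintro rfl
    refine ⟨Nat.ofBits fun i : Fin σ.length => σ[i], Nat.ofBits_lt_two_pow _, ?_⟩
    apply List.ext_getElem
    · simp
    · intro i h₁ h₂
      simp [Nat.testBit_ofBits_lt _ i h₂]

theorem length_allStrings (L : ℕ) : (allStrings L).length = 2 ^ L := by
  simp [allStrings]

theorem nodup_allStrings (L : ℕ) : (allStrings L).Nodup := by
  refine List.Nodup.map_on ?_ List.nodup_range
  intro a ha b hb hab
  rw [List.mem_range] at ha hb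
  refine Nat.eq_of_testBit_eq fun i => ?_
  by_cases hi : i < L
  · exact List.map_inj_left.1 hab i (List.mem_range.2 hi)
  · have hL : 2 ^ L ≤ 2 ^ i := Nat.pow_le_pow_right two_pos (not_lt.1 hi)
    rw [Nat.testBit_lt_two_pow (ha.trans_le hL), Nat.testBit_lt_two_pow (hb.trans_le hL)]

theorem primrec_two_pow : Primrec fun n : ℕ => 2 ^ n :=
  (Primrec.nat_rec₁ 1 (Primrec.nat_mul.comp Primrec.snd (Primrec.const 2)).to₂).of_eq fun n => by
    induction n with
    | zero => rfl
    | succ n ih => simp only [ih, pow_succ]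

theorem primrec_testBit : Primrec₂ Nat.testBit := by
  have h : PrimrecRel fun k i : ℕ => k / 2 ^ i % 2 = 1 :=
    Primrec.eq.comp
      (Primrec.nat_mod.comp
        (Primrec.nat_div.comp Primrec.fst (primrec_two_pow.comp Primrec.snd)) (Primrec.const 2))
      (Primrec.const 1)
  exact h.decide.of_eq fun k i => Nat.testBit_eq_decide_div_mod_eq.symm

theorem primrec_allStrings : Primrec allStrings :=
  Primrec.list_map (Primrec.list_range.comp primrec_two_pow)
    (Primrec.list_map (Primrec.list_range.comp Primrec.fst)
      (primrec_testBit.comp (Primrec.snd.comp Primrec.fst) Primrec.snd).to₂).to₂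

theorem primrec_maxLen : Primrec maxLen :=
  Primrec.list_foldr
    (Primrec.list_map Primrec.id (Primrec.list_length.comp Primrec.snd).to₂)
    (Primrec.const 0)
    (Primrec.nat_max.comp (Primrec.fst.comp Primrec.snd) (Primrec.snd.comp Primrec.snd)).to₂

theorem primrecRel_prefix : PrimrecRel fun τ σ : List Bool => τ <+: σ := by
  have h : PrimrecRel fun τ σ : List Bool => τ = σ.take τ.length :=
    Primrec.eq.comp Primrec.fst
      (Primrec.list_take.comp (Primrec.list_length.comp Primrec.fst) Primrec.snd)
  exact h.of_eq fun _ _ => List.prefix_iff_eq_take.symm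

theorem primrecRel_exists_prefix :
    PrimrecRel fun (σ : List Bool) (G : List (List Bool)) => ∃ τ ∈ G, τ <+: σ :=
  primrecRel_prefix.exists_mem_list.comp Primrec.snd Primrec.fst

theorem length_le_maxLen {G : List (List Bool)} {τ : List Bool} (h : τ ∈ G) :
    τ.length ≤ maxLen G := by
  induction G with
  | nil => simp at h
  | cons a G ih =>
    simp only [maxLen, List.map_cons, List.foldr_cons] at ih ⊢
    rcases List.mem_cons.1 h with rfl | h
    · exact le_max_left _ _
    · exact (ih h).trans (le_max_right _ _)

theorem maxLen_le {G : List (List Bool)} {L : ℕ} (h : ∀ τ ∈ G, τ.length ≤ L) : maxLen G ≤ L := by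
  induction G with
  | nil => simp [maxLen]
  | cons a G ih =>
    simp only [List.mem_cons, forall_eq_or_imp] at h
    exact max_le h.1 (ih h.2)

/-- The strings of length `maxLen G` extending a member of `G`. -/
def cover (G : List (List Bool)) : List (List Bool) :=
  (allStrings (maxLen G)).filter fun σ => decide (∃ τ ∈ G, τ <+: σ)

/-- The strings of length `maxLen G` extending no member of `G`. -/
def coverCompl (G : List (List Bool)) : List (List Bool) :=
  (allStrings (maxLen G)).filter fun σ => decide (¬ ∃ τ ∈ G, τ <+: σ)

theorem primrec_cover : Primrec cover :=
  primrecRel_exists_prefix.listFilter.comp (primrec_allStrings.comp primrec_maxLen) Primrec.id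

theorem primrec_coverCompl : Primrec coverCompl :=
  (PrimrecRel.not primrecRel_exists_prefix).listFilter.comp
    (primrec_allStrings.comp primrec_maxLen) Primrec.id

theorem mu_eq_cover (G : List (List Bool)) :
    mu G = ((cover G).length : ℚ) / 2 ^ maxLen G := by
  have h : (fun σ : List Bool => G.any fun τ => decide (τ <+: σ))
      = fun σ => decide (∃ τ ∈ G, τ <+: σ) := by
    funext σ
    rw [Bool.eq_iff_iff]
    simp
  rw [mu, cover, h]

theorem cover_append_coverCompl_perm (G : List (List Bool)) :
    (cover G ++ coverCompl G).Perm (allStrings (maxLen G)) := by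
  simpa only [cover, coverCompl, decide_not] using
    List.filter_append_perm (fun σ => decide (∃ τ ∈ G, τ <+: σ)) (allStrings (maxLen G))

/-- The measure of a nonempty duplicate-free list of strings of common length `L`. -/
theorem mu_eq_of_length_eq {H : List (List Bool)} {L : ℕ} (hne : H ≠ []) (hnd : H.Nodup)
    (hlen : ∀ σ ∈ H, σ.length = L) : mu H = (H.length : ℚ) / 2 ^ L := by
  have hL : maxLen H = L := by
    obtain ⟨σ, hσ⟩ := List.exists_mem_of_ne_nil H hne
    exact le_antisymm (maxLen_le fun τ hτ => (hlen τ hτ).le)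
      (hlen σ hσ ▸ length_le_maxLen hσ)
  have hperm : (cover H).Perm H := by
    refine (List.perm_ext_iff_of_nodup ((nodup_allStrings _).filter _) hnd).2 fun σ => ?_
    simp only [List.mem_filter, mem_allStrings, decide_eq_true_eq, hL]
    constructor
    · rintro ⟨hσ, τ, hτ, hpre⟩
      rwa [← hpre.eq_of_length ((hlen τ hτ).trans hσ.symm)]
    · exact fun hσ => ⟨hlen σ hσ, σ, hσ, List.prefix_rfl⟩
  rw [mu_eq_cover, hperm.length_eq, hL]

theorem length_take (X : ℕ → Bool) (n : ℕ) : (take X n).length = n := by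
  simp [take]

theorem take_prefix_take (X : ℕ → Bool) {m n : ℕ} (h : m ≤ n) : take X m <+: take X n := by
  obtain ⟨k, rfl⟩ := Nat.exists_eq_add_of_le h
  simp [take, List.range_add]

theorem take_maxLen_mem_cover {X : ℕ → Bool} {G : List (List Bool)} (h : Mem X G) :
    take X (maxLen G) ∈ cover G := by
  obtain ⟨τ, hτ, hX⟩ := h
  simp only [cover, List.mem_filter, mem_allStrings, decide_eq_true_eq]
  exact ⟨length_take _ _, τ, hτ, hX ▸ take_prefix_take X (length_le_maxLen hτ)⟩

/-- A list of `2 ^ (maxLen G - n)` strings of length `maxLen G` that starts with those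
extending a member of `G`. -/
def pad (G : List (List Bool)) (n : ℕ) : List (List Bool) :=
  (cover G ++ coverCompl G).take (2 ^ (maxLen G - n))

theorem primrec_pad : Primrec₂ pad :=
  Primrec.list_take.comp
    (primrec_two_pow.comp (Primrec.nat_sub.comp (primrec_maxLen.comp Primrec.fst) Primrec.snd))
    (Primrec.list_append.comp (primrec_cover.comp Primrec.fst)
      (primrec_coverCompl.comp Primrec.fst))

theorem length_cover_mul_le {G : List (List Bool)} {n : ℕ} (h : mu G ≤ ((2 : ℚ) ^ n)⁻¹) :
    (cover G).length * 2 ^ n ≤ 2 ^ maxLen G := by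
  rw [mu_eq_cover, div_le_iff₀ (by positivity), inv_mul_eq_div, le_div_iff₀ (by positivity)] at h
  exact_mod_cast h

theorem mu_pad {G : List (List Bool)} {n : ℕ} (hn : n ≤ maxLen G) :
    mu (pad G n) = ((2 : ℚ) ^ n)⁻¹ := by
  have hperm := cover_append_coverCompl_perm G
  have hlen : (pad G n).length = 2 ^ (maxLen G - n) := by
    rw [pad, List.length_take, hperm.length_eq, length_allStrings]
    exact min_eq_left (Nat.pow_le_pow_right two_pos (Nat.sub_le _ _))
  rw [mu_eq_of_length_eq (L := maxLen G), hlen]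
  · rw [div_eq_iff (by positivity), inv_mul_eq_div, eq_div_iff (by positivity)]
    push_cast
    rw [← pow_add, Nat.sub_add_cancel hn]
  · rw [← List.length_pos_iff, hlen]
    positivity
  · exact (hperm.nodup_iff.2 (nodup_allStrings _)).sublist (List.take_sublist _ _)
  · intro σ hσ
    exact mem_allStrings.1 (hperm.mem_iff.1 (List.mem_of_mem_take hσ))

theorem le_maxLen_of_mem {X : ℕ → Bool} {G : List (List Bool)} {n : ℕ} (hX : Mem X G)
    (h : mu G ≤ ((2 : ℚ) ^ n)⁻¹) : n ≤ maxLen G := by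
  have hpos := List.length_pos_of_mem (take_maxLen_mem_cover hX)
  exact (Nat.pow_le_pow_iff_right one_lt_two).1
    ((Nat.le_mul_of_pos_left _ hpos).trans (length_cover_mul_le h))

theorem mem_pad {X : ℕ → Bool} {G : List (List Bool)} {n : ℕ} (hX : Mem X G)
    (h : mu G ≤ ((2 : ℚ) ^ n)⁻¹) : Mem X (pad G n) := by
  have hcard : (cover G).length ≤ 2 ^ (maxLen G - n) := by
    rw [← Nat.pow_div (le_maxLen_of_mem hX h) two_pos, Nat.le_div_iff_mul_le (by positivity)]
    exact length_cover_mul_le h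
  refine ⟨take X (maxLen G), ?_, by rw [length_take]⟩
  rw [pad, List.take_append, List.take_of_length_le hcard]
  exact List.mem_append_left _ (take_maxLen_mem_cover hX)

theorem stmt0 (X : ℕ → Bool) :
    MLBPRandom X ↔
      ¬ ∃ G : ℕ → List (List Bool), Primrec G ∧
        (∀ n, mu (G n) = ((2 : ℚ) ^ n)⁻¹) ∧ ∀ n, Mem X (G n) := by
  constructor
  · rintro h ⟨G, hG, hmu, hX⟩
    obtain ⟨n, hn⟩ := h G ⟨hG, fun n => (hmu n).le⟩
    exact hn (hX n)
  · rintro h G ⟨hG, hmu⟩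
    by_contra! hX
    exact h ⟨fun n => pad (G n) n, primrec_pad.comp hG Primrec.id,
      fun n => mu_pad (le_maxLen_of_mem (hX n) (hmu n)), fun n => mem_pad (hX n) (hmu n)⟩

end BP
end

section
/- For any real X, the following are equivalent: (1) X is martingale BP random; (2) there do not exist a primitive recursive martingale d and a primitive recursive function f : ℕ → ℕ such that for every n there exists m ≤ f(n) with d(X↾m) ≥ 2^n; (3) there do not exist a primitive recursive martingale d and a primitive recursive function f : ℕ → ℕ such that d(X↾m) ≥ 2^n for all n and all m ≥ f(n). -/
namespace BP



/-! ### Primitive recursive arithmetic on the rationals -/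

theorem primrec_pow : Primrec₂ ((· ^ ·) : ℕ → ℕ → ℕ) :=
  Primrec₂.unpaired'.1 Nat.Primrec.pow

theorem primrec_dvd : PrimrecRel ((· ∣ ·) : ℕ → ℕ → Prop) :=
  (Primrec.eq.comp (Primrec.nat_mod.comp Primrec.snd Primrec.fst) (Primrec.const 0)).of_eq
    fun p => (Nat.dvd_iff_mod_eq_zero (m := p.1) (n := p.2)).symm

theorem primrec_gcd : Primrec₂ Nat.gcd := by
  have hdvd : PrimrecRel fun (p : ℕ × ℕ) (x : ℕ) => x ∣ p.1 ∧ x ∣ p.2 :=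
    .and (primrec_dvd.comp Primrec.snd (Primrec.fst.comp Primrec.fst))
      (primrec_dvd.comp Primrec.snd (Primrec.snd.comp Primrec.fst))
  refine (Primrec.nat_findGreatest (Primrec.nat_add.comp Primrec.fst Primrec.snd) hdvd).of_eq
    fun ⟨a, b⟩ => ?_
  rw [Nat.findGreatest_eq_iff]
  refine ⟨?_, fun _ => ⟨Nat.gcd_dvd_left a b, Nat.gcd_dvd_right a b⟩, fun n hn hle h => ?_⟩
  · rcases Nat.eq_zero_or_pos a with rfl | ha
    · simp
    · exact (Nat.gcd_le_left b ha).trans (Nat.le_add_right a b)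
  · have hpos : 0 < Nat.gcd a b := by
      refine Nat.pos_of_ne_zero fun h0 => ?_
      rw [Nat.gcd_eq_zero_iff] at h0
      simp only [h0.1, h0.2] at hle
      omega
    exact absurd (Nat.le_of_dvd hpos (Nat.dvd_gcd h.1 h.2)) (by simpa using hn)

/-- The code of a rational as the pair of its numerator and its denominator. -/
def ratCode (q : ℚ) : ℕ := Nat.pair (Equiv.intEquivNat q.num) q.den

/-- `c` is the code of a rational. -/
def IsRatCode (c : ℕ) : Prop :=
  0 < c.unpair.2 ∧ Nat.gcd ((c.unpair.1 + 1) / 2) c.unpair.2 = 1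

instance : DecidablePred IsRatCode := fun _ => inferInstanceAs (Decidable (_ ∧ _))

theorem intEquivNat_add_one_div_two (z : ℤ) : (Equiv.intEquivNat z + 1) / 2 = z.natAbs := by
  rcases z with n | n
  · change (2 * n + 1) / 2 = n
    omega
  · change (2 * n + 1 + 1) / 2 = n + 1
    omega

theorem isRatCode_iff (c : ℕ) : IsRatCode c ↔ ∃ q, ratCode q = c := by
  constructor
  · rintro ⟨h0, h1⟩
    have hz := intEquivNat_add_one_div_two (Equiv.intEquivNat.symm c.unpair.1)
    rw [Equiv.apply_symm_apply] at hz
    rw [hz] at h1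
    exact ⟨⟨Equiv.intEquivNat.symm c.unpair.1, c.unpair.2, h0.ne', h1⟩, by simp [ratCode]⟩
  · rintro ⟨q, rfl⟩
    refine ⟨by simpa [ratCode] using q.den_pos, ?_⟩
    simpa [ratCode, intEquivNat_add_one_div_two] using q.reduced

/-- The code of a rational in the enumeration underlying its `Primcodable` instance, which differs
from the code of the default `Encodable` instance. -/
def ratIndex (q : ℚ) : ℕ := (Primcodable.ofDenumerable ℚ).toEncodable.encode q

theorem primrec_ratIndex : Primrec ratIndex := Primrec.encode

theorem ratIndex_eq_count (q : ℚ) : ratIndex q = Nat.count IsRatCode (ratCode q) := by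
  let := @Encodable.decidableRangeEncode ℚ Rat.instEncodable
  have h : ratIndex q = (List.range (ratCode q)).countP
      (· ∈ Set.range (@Encodable.encode ℚ Rat.instEncodable)) := rfl
  rw [h, Nat.count]
  refine List.countP_congr fun c _ => ?_
  simp only [decide_eq_true_eq]
  exact (isRatCode_iff c).symm

theorem primrecPred_isRatCode : PrimrecPred IsRatCode := by
  have h₁ : Primrec fun c : ℕ => c.unpair.1 := Primrec.fst.comp Primrec.unpair
  have h₂ : Primrec fun c : ℕ => c.unpair.2 := Primrec.snd.comp Primrec.unpair
  exact .and (Primrec.nat_lt.comp (Primrec.const 0) h₂)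
    (Primrec.eq.comp (primrec_gcd.comp
      (Primrec.nat_div.comp (Primrec.succ.comp h₁) (Primrec.const 2)) h₂) (Primrec.const 1))

theorem primrec_count_isRatCode : Primrec (Nat.count IsRatCode) :=
  (Primrec.list_length.comp
    ((Primrec.listFilter primrecPred_isRatCode).comp Primrec.list_range)).of_eq fun n => by
      rw [Nat.count, List.countP_eq_length_filter]

theorem ratCode_natCast (n : ℕ) : ratCode n = Nat.pair (2 * n) 1 := rfl

theorem ratCode_le (q : ℚ) : ratCode q ≤ Nat.pair (2 * ratIndex q) 1 := by
  have hmono : StrictMono fun n : ℕ => Nat.count IsRatCode (ratCode n) := fun a b hab =>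
    Nat.count_strict_mono ((isRatCode_iff _).2 ⟨_, rfl⟩)
      (Nat.pair_lt_pair_left 1 (by omega : 2 * a < 2 * b))
  by_contra! hlt
  rw [← ratCode_natCast] at hlt
  have h := Nat.count_strict_mono ((isRatCode_iff _).2 ⟨_, rfl⟩) hlt
  rw [← ratIndex_eq_count q] at h
  exact absurd (hmono.le_apply (x := ratIndex q)) (not_le.2 h)

theorem primrec_ratCode : Primrec ratCode := by
  refine Primrec.of_graph ⟨_, Primrec₂.natPair.comp
    (Primrec.nat_double.comp primrec_ratIndex) (Primrec.const 1), ratCode_le⟩ ?_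
  have h : PrimrecRel fun (q : ℚ) (c : ℕ) =>
      IsRatCode c ∧ Nat.count IsRatCode c = ratIndex q :=
    .and (primrecPred_isRatCode.comp Primrec.snd)
      (Primrec.eq.comp (primrec_count_isRatCode.comp Primrec.snd)
        (primrec_ratIndex.comp Primrec.fst))
  refine h.of_eq fun q c => ⟨fun ⟨hc, hcount⟩ => ?_, ?_⟩
  · rw [ratIndex_eq_count] at hcount
    exact (Nat.count_injective hc ((isRatCode_iff _).2 ⟨q, rfl⟩) hcount).symm
  · rintro rfl
    exact ⟨(isRatCode_iff _).2 ⟨q, rfl⟩, (ratIndex_eq_count q).symm⟩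

theorem primrec_natAbs_num : Primrec fun q : ℚ => q.num.natAbs :=
  (Primrec.nat_div.comp (Primrec.succ.comp (Primrec.fst.comp (Primrec.unpair.comp primrec_ratCode)))
    (Primrec.const 2)).of_eq fun q => by
      simpa [ratCode] using intEquivNat_add_one_div_two q.num

theorem primrec_den : Primrec fun q : ℚ => q.den :=
  (Primrec.snd.comp (Primrec.unpair.comp primrec_ratCode)).of_eq fun q => by simp [ratCode]

theorem ratCode_natCast_div (a b : ℕ) (hb : b ≠ 0) :
    ratCode ((a : ℚ) / b) = Nat.pair (2 * (a / Nat.gcd a b)) (b / Nat.gcd a b) := by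
  have h : ((a : ℚ) / b) = mkRat a b := by simp [Rat.mkRat_eq_div]
  have hnum : (mkRat a b).num = ((a / Nat.gcd a b : ℕ) : ℤ) := by
    simp [Rat.num_mkRat, hb, Nat.gcd_comm]
  have hden : (mkRat a b).den = b / Nat.gcd a b := by
    simp [Rat.den_mkRat, hb, Nat.gcd_comm]
  rw [h, ratCode, hnum, hden]
  rfl

theorem primrec_natCast_div : Primrec₂ fun a b : ℕ => (a : ℚ) / b := by
  have hgcd : Primrec fun p : ℕ × ℕ => Nat.gcd p.1 p.2 := primrec_gcd
  have hcode : Primrec fun p : ℕ × ℕ =>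
      Nat.count IsRatCode (Nat.pair (2 * (p.1 / Nat.gcd p.1 p.2)) (p.2 / Nat.gcd p.1 p.2)) :=
    primrec_count_isRatCode.comp (Primrec₂.natPair.comp
      (Primrec.nat_double.comp (Primrec.nat_div.comp Primrec.fst hgcd))
      (Primrec.nat_div.comp Primrec.snd hgcd))
  refine Primrec.encode_iff.1 ((Primrec.ite (Primrec.eq.comp Primrec.snd (Primrec.const 0))
    (Primrec.const (ratIndex 0)) hcode).of_eq fun ⟨a, b⟩ => ?_)
  split_ifs with h
  · simp only at h
    simp [h, ratIndex]
  · change _ = ratIndex ((a : ℚ) / b)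
    rw [ratIndex_eq_count, ratCode_natCast_div a b h]

theorem abs_eq_natAbs_num_div_den (q : ℚ) : |q| = (q.num.natAbs : ℚ) / q.den := by
  conv_lhs => rw [← Rat.num_div_den q]
  rw [abs_div, Nat.abs_cast, Nat.cast_natAbs, Int.cast_abs]

theorem primrec_abs_add_abs : Primrec₂ fun q r : ℚ => |q| + |r| := by
  have hq := primrec_natAbs_num.comp (Primrec.fst (α := ℚ) (β := ℚ))
  have hr := primrec_natAbs_num.comp (Primrec.snd (α := ℚ) (β := ℚ))
  have hq' := primrec_den.comp (Primrec.fst (α := ℚ) (β := ℚ))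
  have hr' := primrec_den.comp (Primrec.snd (α := ℚ) (β := ℚ))
  refine (primrec_natCast_div.comp
    (Primrec.nat_add.comp (Primrec.nat_mul.comp hq hr') (Primrec.nat_mul.comp hq' hr))
    (Primrec.nat_mul.comp hq' hr')).of_eq fun ⟨q, r⟩ => ?_
  have h₁ : (q.den : ℚ) ≠ 0 := by exact_mod_cast q.den_nz
  have h₂ : (r.den : ℚ) ≠ 0 := by exact_mod_cast r.den_nz
  simp only [abs_eq_natAbs_num_div_den]
  rw [div_add_div _ _ h₁ h₂]
  push_cast
  rfl

theorem primrec_abs_div_two_pow : Primrec₂ fun (q : ℚ) (k : ℕ) => |q| / 2 ^ k := by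
  refine (primrec_natCast_div.comp (primrec_natAbs_num.comp Primrec.fst)
    (Primrec.nat_mul.comp (primrec_den.comp Primrec.fst)
      (primrec_pow.comp (Primrec.const 2) Primrec.snd))).of_eq fun ⟨q, k⟩ => ?_
  simp only [abs_eq_natAbs_num_div_den]
  rw [div_div]
  push_cast
  rfl

theorem primrecRel_two_pow_le_abs : PrimrecRel fun (k : ℕ) (q : ℚ) => (2 : ℚ) ^ k ≤ |q| := by
  refine (Primrec.nat_le.comp
    (Primrec.nat_mul.comp (primrec_pow.comp (Primrec.const 2) Primrec.fst)
      (primrec_den.comp Primrec.snd)) (primrec_natAbs_num.comp Primrec.snd)).of_eq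
    fun ⟨k, q⟩ => ?_
  have h : (0 : ℚ) < q.den := by exact_mod_cast q.den_pos
  simp only [abs_eq_natAbs_num_div_den]
  rw [le_div_iff₀ h]
  exact_mod_cast Iff.rfl

/-! ### The savings martingale -/

/-- One step of the savings strategy. The state consists of the string read so far, the amount
saved, and the number `j` of savings made; the capital still at stake is `d σ / 2 ^ j`. Half of it
is saved as soon as it reaches `2`. -/
def savingsStep (d : List Bool → ℚ) (s : List Bool × ℚ × ℕ) (b : Bool) : List Bool × ℚ × ℕ :=
  if 2 ^ (s.2.2 + 1) ≤ |d (s.1 ++ [b])| then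
    (s.1 ++ [b], |s.2.1| + |(|d (s.1 ++ [b])| / 2 ^ (s.2.2 + 1))|, s.2.2 + 1)
  else (s.1 ++ [b], s.2)

/-- The state of the savings strategy after reading `σ`. -/
def savingsState (d : List Bool → ℚ) (σ : List Bool) : List Bool × ℚ × ℕ :=
  σ.foldl (savingsStep d) ([], 0, 0)

/-- The total capital of the savings strategy. -/
def savings (d : List Bool → ℚ) (σ : List Bool) : ℚ :=
  |(savingsState d σ).2.1| + |(|d σ| / 2 ^ (savingsState d σ).2.2)|

theorem savingsState_append (d : List Bool → ℚ) (σ : List Bool) (b : Bool) :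
    savingsState d (σ ++ [b]) = savingsStep d (savingsState d σ) b := by
  simp [savingsState]

theorem savingsState_fst (d : List Bool → ℚ) (σ : List Bool) : (savingsState d σ).1 = σ := by
  induction σ using List.reverseRecOn with
  | nil => rfl
  | append_singleton σ b ih =>
    rw [savingsState_append, savingsStep]
    split_ifs <;> simp [ih]

theorem primrec_savings {d : List Bool → ℚ} (hd : Primrec d) : Primrec (savings d) := by
  have hext : Primrec fun p : (List Bool × ℚ × ℕ) × Bool => p.1.1 ++ [p.2] :=
    Primrec.list_concat.comp (Primrec.fst.comp Primrec.fst) Primrec.snd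
  have hj : Primrec fun p : (List Bool × ℚ × ℕ) × Bool => p.1.2.2 + 1 :=
    Primrec.succ.comp (Primrec.snd.comp (Primrec.snd.comp Primrec.fst))
  have hstep : Primrec₂ (savingsStep d) :=
    Primrec.ite (primrecRel_two_pow_le_abs.comp hj (hd.comp hext))
      (Primrec.pair hext (Primrec.pair (primrec_abs_add_abs.comp
        (Primrec.fst.comp (Primrec.snd.comp Primrec.fst))
        (primrec_abs_div_two_pow.comp (hd.comp hext) hj)) hj))
      (Primrec.pair hext (Primrec.snd.comp Primrec.fst))
  have hstate : Primrec (savingsState d) :=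
    Primrec.list_foldl Primrec.id (Primrec.const ([], 0, 0))
      (hstep.comp (Primrec.fst.comp Primrec.snd) (Primrec.snd.comp Primrec.snd)).to₂
  exact primrec_abs_add_abs.comp (Primrec.fst.comp (Primrec.snd.comp hstate))
    (primrec_abs_div_two_pow.comp hd (Primrec.snd.comp (Primrec.snd.comp hstate)))

theorem IsMartingale.le_two_mul {d : List Bool → ℚ} (hd : IsMartingale d) (σ : List Bool)
    (b : Bool) : d (σ ++ [b]) ≤ 2 * d σ := by
  have h := hd.2.2 σ
  have h₀ := hd.2.1 (σ ++ [false])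
  have h₁ := hd.2.1 (σ ++ [true])
  cases b <;> linarith

theorem savingsState_bounds {d : List Bool → ℚ} (hd : IsMartingale d) (σ : List Bool) :
    ((savingsState d σ).2.2 : ℚ) ≤ (savingsState d σ).2.1 ∧
      d σ < 2 ^ ((savingsState d σ).2.2 + 1) := by
  induction σ using List.reverseRecOn with
  | nil => simp [savingsState, hd.1]
  | append_singleton σ b ih =>
    obtain ⟨hbank, hcap⟩ := ih
    have hle := hd.le_two_mul σ b
    rw [savingsState_append, savingsStep, savingsState_fst]
    simp only [abs_of_nonneg (hd.2.1 (σ ++ [b]))]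
    split_ifs with h
    · refine ⟨?_, ?_⟩
      · have hsaved : (1 : ℚ) ≤ d (σ ++ [b]) / 2 ^ ((savingsState d σ).2.2 + 1) :=
          (one_le_div (by positivity)).2 h
        push_cast
        exact add_le_add (hbank.trans (le_abs_self _)) (hsaved.trans (le_abs_self _))
      · rw [pow_succ _ ((savingsState d σ).2.2 + 1)]
        linarith
    · exact ⟨hbank, not_le.1 h⟩

theorem savingsState_nonneg {d : List Bool → ℚ} (hd : IsMartingale d) (σ : List Bool) :
    0 ≤ (savingsState d σ).2.1 :=
  (Nat.cast_nonneg _).trans (savingsState_bounds hd σ).1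

theorem savings_eq {d : List Bool → ℚ} (hd : IsMartingale d) (σ : List Bool) :
    savings d σ = (savingsState d σ).2.1 + d σ / 2 ^ (savingsState d σ).2.2 := by
  rw [savings, abs_of_nonneg (savingsState_nonneg hd σ), abs_of_nonneg (hd.2.1 σ),
    abs_of_nonneg (div_nonneg (hd.2.1 σ) (by positivity))]

theorem savings_append {d : List Bool → ℚ} (hd : IsMartingale d) (σ : List Bool) (b : Bool) :
    savings d (σ ++ [b]) =
      (savingsState d σ).2.1 + d (σ ++ [b]) / 2 ^ (savingsState d σ).2.2 := by
  have hpos := hd.2.1 (σ ++ [b])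
  rw [savings_eq hd, savingsState_append, savingsStep, savingsState_fst]
  split_ifs with h
  · simp only
    rw [abs_of_nonneg (savingsState_nonneg hd σ), abs_of_nonneg hpos,
      abs_of_nonneg (div_nonneg hpos (by positivity))]
    field_simp
    ring
  · rfl

theorem isMartingale_savings {d : List Bool → ℚ} (hd : IsMartingale d) :
    IsMartingale (savings d) := by
  refine ⟨by simp [savings, savingsState, hd.1], fun σ => by unfold savings; positivity,
    fun σ => ?_⟩
  rw [savings_append hd, savings_append hd, savings_eq hd, hd.2.2 σ]
  ring

theorem take_succ (X : ℕ → Bool) (n : ℕ) : take X (n + 1) = take X n ++ [X n] := by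
  simp [take, List.range_succ]

theorem monotone_bank (d : List Bool → ℚ) (X : ℕ → Bool) :
    Monotone fun n => (savingsState d (take X n)).2.1 := by
  refine monotone_nat_of_le_succ fun n => ?_
  rw [take_succ, savingsState_append, savingsStep]
  split_ifs
  · exact (le_abs_self _).trans (le_add_of_nonneg_right (abs_nonneg _))
  · exact le_rfl

theorem le_savings {d : List Bool → ℚ} (hd : IsMartingale d) {X : ℕ → Bool} {k m₀ m : ℕ}
    (hk : (2 : ℚ) ^ k ≤ d (take X m₀)) (hm : m₀ ≤ m) : (k : ℚ) ≤ savings d (take X m) := by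
  obtain ⟨hbank, hcap⟩ := savingsState_bounds hd (take X m₀)
  have hkj : k < (savingsState d (take X m₀)).2.2 + 1 :=
    (pow_lt_pow_iff_right₀ one_lt_two).1 (hk.trans_lt hcap)
  have hkj' : (k : ℚ) ≤ (savingsState d (take X m₀)).2.2 := by
    exact_mod_cast Nat.lt_succ_iff.1 hkj
  rw [savings_eq hd]
  have hmono : (savingsState d (take X m₀)).2.1 ≤ (savingsState d (take X m)).2.1 :=
    monotone_bank d X hm
  have hpos : 0 ≤ d (take X m) / 2 ^ (savingsState d (take X m)).2.2 :=
    div_nonneg (hd.2.1 _) (by positivity)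
  linarith

theorem stmt2 (X : ℕ → Bool) :
    (MartingaleBPRandom X ↔
      ¬ ∃ (d : List Bool → ℚ) (f : ℕ → ℕ), Primrec d ∧ IsMartingale d ∧ Primrec f ∧
        ∀ n, ∃ m ≤ f n, (2 : ℚ) ^ n ≤ d (take X m)) ∧
    (MartingaleBPRandom X ↔
      ¬ ∃ (d : List Bool → ℚ) (f : ℕ → ℕ), Primrec d ∧ IsMartingale d ∧ Primrec f ∧
        ∀ n m, f n ≤ m → (2 : ℚ) ^ n ≤ d (take X m)) := by
  have toWeak : (∃ d : List Bool → ℚ, Primrec d ∧ IsMartingale d ∧ SucceedsPR d X) →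
      ∃ (d : List Bool → ℚ) (f : ℕ → ℕ), Primrec d ∧ IsMartingale d ∧ Primrec f ∧
        ∀ n, ∃ m ≤ f n, (2 : ℚ) ^ n ≤ d (take X m) :=
    fun ⟨d, hd, hmart, f, hf, h⟩ => ⟨d, f, hd, hmart, hf, fun n => ⟨f n, le_rfl, h n⟩⟩
  have toStrong : (∃ (d : List Bool → ℚ) (f : ℕ → ℕ), Primrec d ∧ IsMartingale d ∧ Primrec f ∧
        ∀ n, ∃ m ≤ f n, (2 : ℚ) ^ n ≤ d (take X m)) →
      ∃ (d : List Bool → ℚ) (f : ℕ → ℕ), Primrec d ∧ IsMartingale d ∧ Primrec f ∧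
        ∀ n m, f n ≤ m → (2 : ℚ) ^ n ≤ d (take X m) := by
    rintro ⟨d, f, hd, hmart, hf, h⟩
    refine ⟨savings d, fun n => f (2 ^ n), primrec_savings hd, isMartingale_savings hmart,
      hf.comp (primrec_pow.comp (Primrec.const 2) Primrec.id), fun n m hm => ?_⟩
    obtain ⟨m₀, hm₀, hd₀⟩ := h (2 ^ n)
    exact_mod_cast le_savings hmart hd₀ (hm₀.trans hm)
  have ofStrong : (∃ (d : List Bool → ℚ) (f : ℕ → ℕ), Primrec d ∧ IsMartingale d ∧ Primrec f ∧
        ∀ n m, f n ≤ m → (2 : ℚ) ^ n ≤ d (take X m)) →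
      ∃ d : List Bool → ℚ, Primrec d ∧ IsMartingale d ∧ SucceedsPR d X :=
    fun ⟨d, f, hd, hmart, hf, h⟩ => ⟨d, hd, hmart, f, hf, fun n => h n (f n) le_rfl⟩
  exact ⟨not_congr ⟨toWeak, fun h => ofStrong (toStrong h)⟩,
    not_congr ⟨fun h => toStrong (toWeak h), ofStrong⟩⟩

end BP
end
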